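/- The split product ∘ is associative on nonempty parking functions, and every nonempty parking function a admits a unique factorization a = a^(1) ∘ a^(2) ∘ ⋯ ∘ a^(k) as a split product of unsplitable parking functions. -/

import Mathlib

open scoped Classical

/-- Words on natural numbers (letters are intended to be positive integers). -/
abbrev W : Type := List ℕ

/-- `IsPF a` : the word `a` is a parking function, i.e. all its letters are
positive and its nondecreasing rearrangement `b₁ b₂ ⋯ bₙ` satisfies `bᵢ ≤ i`. -/
def IsPF (a : W) : Prop :=
  (∀ x ∈ a, 1 ≤ x) ∧
    ∀ i, i < a.length → (a.insertionSort (· ≤ ·)).getD i 0 ≤ i + 1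

/-- Split a word into the consecutive segments beginning at its
left-to-right minima (in the order in which they occur in the word). -/
def segs : W → List W
  | [] => []
  | x :: xs =>
      (x :: xs.takeWhile fun y => x ≤ y) :: segs (xs.dropWhile fun y => x ≤ y)
termination_by a => a.length
decreasing_by
  simpa using Nat.lt_succ_of_le (List.dropWhile_sublist _).length_le

/-- The LR-decomposition `F_a` of a word `a`: the sequence of segments beginning
at the left-to-right minima, listed in increasing order of their minimal letters
(i.e. in reverse order of occurrence in `a`). -/
def LR (a : W) : List W := (segs a).reverse

/-- The word `w_k ⋯ w_2 w_1` encoded by an LR-decomposition `(w_1, …, w_k)`. -/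
def wordOf (F : List W) : W := F.reverse.flatten

/-- A word is dominated if it is nonempty and its first letter is its minimal letter. -/
def Dominated (w : W) : Prop := w ≠ [] ∧ ∀ x ∈ w, w.headD 0 ≤ x

/-- The minimal letter of a word (`0` for the empty word). -/
def minW (w : W) : ℕ := (w.min?).getD 0

/-- Add `m` to every letter of a word. -/
def shiftW (m : ℕ) (w : W) : W := w.map (· + m)

/-- Add `m` to every letter of every word of a sequence of words. -/
def shiftF (m : ℕ) (F : List W) : List W := F.map (shiftW m)

/-- The word whose LR-decomposition is the finite set of words `G`:
sort `G` increasingly (for dominated words with distinct minimal letters the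
lexicographic order agrees with comparing the minimal letters) and concatenate
in decreasing order. -/
noncomputable def wordOfSet (G : Finset W) : W := (G.sort (· ≤ ·)).reverse.flatten

/-- Given vertex sets `X`, `Y` (of words) and a set `Θ` of edges, the resulting
set of words: concatenations `u ++ w` over edges `(u, w) ∈ Θ`, together with all
unmatched words of `X` and of `Y`. -/
noncomputable def glueSet (X Y : Finset W) (Θ : Finset (W × W)) : Finset W :=
  Θ.image (fun p => p.1 ++ p.2) ∪
    X.filter (fun u => ∀ p ∈ Θ, p.1 ≠ u) ∪
    Y.filter (fun w => ∀ p ∈ Θ, p.2 ≠ w)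

/-- `R(a,b)` : the set of matchings between `F_a` and `F_b + m` (`m` the length
of `a`), encoded as sets of edges in which no vertex occurs twice. -/
noncomputable def Rset (a b : W) : Finset (Finset (W × W)) :=
  ((LR a).toFinset ×ˢ (shiftF a.length (LR b)).toFinset).powerset.filter
    (fun Θ => ∀ p ∈ Θ, ∀ q ∈ Θ, (p.1 = q.1 ∨ p.2 = q.2) → p = q)

/-- `aΘb` : the parking function whose LR-decomposition consists of the
concatenations `u ⬝ (w + m)` over the edges `(u, w + m)` of `Θ` together with all
unmatched words of `F_a` and of `F_b + m`. -/
noncomputable def mTheta (a b : W) (Θ : Finset (W × W)) : W :=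
  wordOfSet (glueSet (LR a).toFinset (shiftF a.length (LR b)).toFinset Θ)

/-- `d(a) = min { i : #{ j : a_j ≤ i } < i }`. -/
def dVal (a : W) : ℕ :=
  Nat.find (p := fun i => (a.filter (fun x => x ≤ i)).length < i)
    ⟨a.length + 1, Nat.lt_succ_of_le (List.length_filter_le _ _)⟩

/-- One step of the parkization algorithm: decrement every letter greater
than `d(a)`.  (This is the identity when `a` is a parking function.) -/
def parkStep (a : W) : W := a.map fun x => if dVal a < x then x - 1 else x

/-- Auxiliary fueled version of the parkization algorithm. -/
def parkFuel : ℕ → W → W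
  | 0, a => a
  | k + 1, a => if dVal a = a.length + 1 then a else parkFuel k (parkStep a)

/-- The parkization `Park a` of a word `a`.  (For a word with positive letters
the algorithm needs at most `a.sum` steps, so the fuel below suffices.) -/
def Park (a : W) : W := parkFuel a.sum a

/-- The subword of `a` obtained by keeping exactly the words of `F_a`
belonging to `S`. -/
def subWord (a : W) (S : Finset W) : W := wordOf ((LR a).filter (· ∈ S))

/-- The free module with basis indexed by words; the Hopf algebra `PFSym` is
its submodule spanned by `{M_a : a ∈ P}`. -/
abbrev FW (K : Type) [Field K] : Type := W →₀ K

/-- The monomial basis element `M_a`. -/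
noncomputable def Mb (K : Type) [Field K] (a : W) : FW K := Finsupp.single a 1

/-- `M_a ⋆ M_b = Σ_{Θ ∈ R(a,b)} M_{aΘb}` on basis elements. -/
noncomputable def mulSingle (K : Type) [Field K] (a b : W) : FW K :=
  ∑ Θ ∈ Rset a b, Mb K (mTheta a b Θ)

/-- The product `⋆`, extended bilinearly. -/
noncomputable def starF (K : Type) [Field K] (x y : FW K) : FW K :=
  x.sum fun a ca => y.sum fun b cb => (ca * cb) • mulSingle K a b

/-- The free module with basis indexed by pairs of words; it realizes the
tensor square of `FW K` via `M_a ⊗ M_b ↦ single (a,b)`. -/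
abbrev FW2 (K : Type) [Field K] : Type := (W × W) →₀ K

/-- `Δ(M_a) = Σ M_{Park a'} ⊗ M_{Park a''}` over ordered pairs `(a', a'')` of
subwords of `a` with `F_{a'} ⊍ F_{a''} = F_a` (encoded by the subset
`S ⊆ F_a` of words kept in `a'`). -/
noncomputable def deltaSingle (K : Type) [Field K] (a : W) : FW2 K :=
  ∑ S ∈ ((LR a).toFinset).powerset,
    Finsupp.single
      (Park (subWord a S), Park (subWord a (((LR a).toFinset) \ S))) 1

/-- The coproduct `Δ`, extended linearly. -/
noncomputable def deltaF (K : Type) [Field K] (x : FW K) : FW2 K :=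
  x.sum fun a ca => ca • deltaSingle K a

/-- The componentwise product on the tensor square, on basis elements:
`(M_a ⊗ M_b) ⋆ (M_c ⊗ M_d) = (M_a ⋆ M_c) ⊗ (M_b ⋆ M_d)`. -/
noncomputable def star2Single (K : Type) [Field K] (p q : W × W) : FW2 K :=
  ∑ Θ ∈ Rset p.1 q.1, ∑ Θ' ∈ Rset p.2 q.2,
    Finsupp.single (mTheta p.1 q.1 Θ, mTheta p.2 q.2 Θ') 1

/-- The componentwise product on the tensor square, extended bilinearly. -/
noncomputable def star2F (K : Type) [Field K] (x y : FW2 K) : FW2 K :=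
  x.sum fun p cp => y.sum fun q cq => (cp * cq) • star2Single K p q

/-- The counit `ε` on basis elements. -/
noncomputable def epsW (K : Type) [Field K] (a : W) : K := if a = [] then 1 else 0

/-- `F_a ∘ F_b` : concatenate the `i`-th words of `F_a` and `F_b + m`
for `i ≤ min(r,s)` and keep the remaining unpaired words. -/
def splitLR (F G : List W) : List W :=
  List.zipWith (· ++ ·) F G ++ F.drop G.length ++ G.drop F.length

/-- The split product `a ∘ b`. -/
def splitProd (a b : W) : W := wordOf (splitLR (LR a) (shiftF a.length (LR b)))

/-- A nonempty parking function is unsplitable if it is not the split product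
of two nonempty parking functions. -/
def UnsplitablePF (a : W) : Prop :=
  IsPF a ∧ a ≠ [] ∧
    ¬ ∃ b c : W, IsPF b ∧ IsPF c ∧ b ≠ [] ∧ c ≠ [] ∧ a = splitProd b c

/-- The slash product `a | b = (b₁+m) ⋯ (bₙ+m) a₁ ⋯ a_m`. -/
def slashProd (a b : W) : W := shiftW a.length b ++ a

/-- A nonempty parking function is atomic if it is not the slash product
of two nonempty parking functions. -/
def AtomicPF (a : W) : Prop :=
  IsPF a ∧ a ≠ [] ∧
    ¬ ∃ b c : W, IsPF b ∧ IsPF c ∧ b ≠ [] ∧ c ≠ [] ∧ a = slashProd b c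

/-- `u ≺* v` : either `v` is a proper initial subword of `u`, or `u` is not a
proper initial subword of `v` and `u` precedes `v` lexicographically. -/
def precStar (u v : W) : Prop :=
  (v <+: u ∧ v ≠ u) ∨ (¬ (u <+: v ∧ u ≠ v) ∧ List.Lex (· < ·) u v)

/-- `a ≺*_lex b` : `F_a` strictly precedes `F_b` in the lexicographic order
on sequences of words induced by `≺*`. -/
def precStarLex (a b : W) : Prop := List.Lex precStar (LR a) (LR b)

/-- The covering relation of `≤_*` : `b` covers `a` if `F_b` is obtained from
`F_a = (w_1, …, w_r)` by replacing `w_i` by `w_i ⬝ w_j` and removing `w_j`,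
for some `i < j` such that every letter of `w_i` is at most every letter of `w_j`. -/
def CovStar (a b : W) : Prop :=
  ∃ i j, i < j ∧ j < (LR a).length ∧
    (∀ x ∈ (LR a).getD i [], ∀ y ∈ (LR a).getD j [], x ≤ y) ∧
    LR b = ((LR a).set i ((LR a).getD i [] ++ (LR a).getD j [])).eraseIdx j

/-- The partial order `≤_*` on parking functions, generated by the covering
relations. -/
def leStar (a b : W) : Prop := Relation.ReflTransGen CovStar a b

/-- The finite set of all parking functions of length `n`. -/
noncomputable def pfFinset (n : ℕ) : Finset W :=
  ((Finset.univ : Finset (Fin n → Fin n)).image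
      (fun f => List.ofFn fun i => (f i).val + 1)).filter IsPF

/-- The basis element `Q_a = Σ_{a ≤_* b} M_b`. -/
noncomputable def Qb (K : Type) [Field K] (a : W) : FW K :=
  ∑ b ∈ (pfFinset a.length).filter (fun b => leStar a b), Mb K b

/-- `Q_x ⊗ Q_y` as an element of the tensor square. -/
noncomputable def QT (K : Type) [Field K] (x y : W) : FW2 K :=
  ∑ b ∈ (pfFinset x.length).filter (fun b => leStar x b),
    ∑ c ∈ (pfFinset y.length).filter (fun c => leStar y c),
      Finsupp.single (b, c) 1

/-- `a` is a nonincreasing word. -/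
def NonInc (a : W) : Prop := a.Chain' (fun x y => y ≤ x)

/-- Every word of the LR-decomposition of `a` is nondecreasing. -/
def Nprop (a : W) : Prop := ∀ w ∈ LR a, w.Chain' (· ≤ ·)

/-- The words of the LR-decomposition of `a` have pairwise disjoint sets of letters. -/
def Dprop (a : W) : Prop := (LR a).Pairwise (fun u v => ∀ x ∈ u, x ∉ v)

/-- `a` is a permutation of `{1, …, n}` viewed as a word. -/
def Sprop (a : W) : Prop := a.Perm (List.range' 1 a.length)


def VSeg (S : List W) : Prop :=
  (∀ w ∈ S, Dominated w) ∧ S.Pairwise (fun u v => v.headD 0 < u.headD 0)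

def VLR (F : List W) : Prop :=
  (∀ w ∈ F, Dominated w) ∧ F.Pairwise (fun u v => u.headD 0 < v.headD 0)

theorem segs_flatten (a : W) : (segs a).flatten = a := by
  induction a using segs.induct with
  | case1 => simp [segs]
  | case2 x xs ih =>
    rw [segs]
    simp only [List.flatten_cons, ih, List.cons_append, List.takeWhile_append_dropWhile]

theorem segs_head_lt (a : W) (x : ℕ) (h : ∀ y ∈ a.head?, y < x) :
    VSeg (segs a) ∧ ∀ w ∈ segs a, w.headD 0 < x := by
  induction a using segs.induct generalizing x with
  | case1 => simp [segs, VSeg]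
  | case2 y ys ih =>
    rw [segs]
    have h1 : y < x := by simpa using h
    have h2 := ih y (by
      intro z hz
      have := List.head?_dropWhile_not (fun t => decide (y ≤ t)) ys
      rw [Option.mem_def] at hz
      rw [hz] at this
      simpa using this)
    obtain ⟨⟨h3, h4⟩, h5⟩ := h2
    refine ⟨⟨?_, ?_⟩, ?_⟩
    · intro w hw
      rcases List.mem_cons.1 hw with rfl | hw
      · refine ⟨by simp, ?_⟩
        intro z hz
        rcases List.mem_cons.1 hz with rfl | hz
        · simp
        · simpa using List.mem_takeWhile_imp hz
      · exact h3 w hw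
    · refine List.pairwise_cons.2 ⟨?_, h4⟩
      intro w hw
      simpa using h5 w hw
    · intro w hw
      rcases List.mem_cons.1 hw with rfl | hw
      · simpa using h1
      · exact (h5 w hw).trans h1

theorem vseg_segs (a : W) : VSeg (segs a) :=
  (segs_head_lt a (a.headD 0 + 1) (by cases a <;> simp)).1

theorem segs_of_vseg (S : List W) (h : VSeg S) : segs S.flatten = S := by
  induction S with
  | nil => simp [segs]
  | cons w S ih =>
    obtain ⟨h1, h2⟩ := h
    rw [List.pairwise_cons] at h2
    have hS := ih ⟨fun v hv => h1 v (by simp [hv]), h2.2⟩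
    have hw := h1 w (by simp)
    cases w with
    | nil => exact absurd rfl hw.1
    | cons x xs =>
      have hx : ∀ y ∈ xs, (decide (x ≤ y)) = true := by
        intro y hy
        have := hw.2 y (by simp [hy])
        simpa using this
      rw [List.flatten_cons, List.cons_append, segs,
        List.takeWhile_append_of_pos hx, List.dropWhile_append_of_pos hx]
      cases S with
      | nil => simp [segs]
      | cons v S =>
        have hv := h1 v (by simp)
        have hl := h2.1 v (by simp)
        cases v with
        | nil => exact absurd rfl hv.1
        | cons y ys =>
          have hy : ¬ x ≤ y := by simpa using hl
          simp only [List.flatten_cons, List.cons_append] at hS ⊢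
          simp [hy, hS]

theorem wordOf_LR (a : W) : wordOf (LR a) = a := by
  simp [wordOf, LR, segs_flatten]

theorem vLR_LR (a : W) : VLR (LR a) := by
  have h := vseg_segs a
  refine ⟨?_, ?_⟩
  · intro w hw
    exact h.1 w (by simpa [LR] using hw)
  · rw [LR, List.pairwise_reverse]
    exact h.2

theorem LR_wordOf (F : List W) (h : VLR F) : LR (wordOf F) = F := by
  rw [LR, wordOf, segs_of_vseg]
  · simp
  · refine ⟨?_, ?_⟩
    · intro w hw
      exact h.1 w (by simpa using hw)
    · rw [List.pairwise_reverse]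
      exact h.2

theorem mem_wordOf (F : List W) (x : ℕ) : x ∈ wordOf F ↔ ∃ w ∈ F, x ∈ w := by
  simp [wordOf]

theorem splitLR_nil_left (G : List W) : splitLR [] G = G := by simp [splitLR]
theorem splitLR_nil_right (F : List W) : splitLR F [] = F := by simp [splitLR]
theorem splitLR_cons (u w : W) (F G : List W) :
    splitLR (u :: F) (w :: G) = (u ++ w) :: splitLR F G := by simp [splitLR]

theorem splitLR_assoc (F G H : List W) :
    splitLR (splitLR F G) H = splitLR F (splitLR G H) := by
  induction F generalizing G H with
  | nil => simp [splitLR_nil_left]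
  | cons u F ih =>
    cases G with
    | nil => simp [splitLR_nil_left, splitLR_nil_right]
    | cons v G =>
      cases H with
      | nil => simp [splitLR_nil_right]
      | cons w H => simp [splitLR_cons, ih]

theorem splitLR_map (f : W → W) (hf : ∀ u v, f (u ++ v) = f u ++ f v) (F G : List W) :
    (splitLR F G).map f = splitLR (F.map f) (G.map f) := by
  induction F generalizing G with
  | nil => simp [splitLR_nil_left]
  | cons u F ih =>
    cases G with
    | nil => simp [splitLR_nil_right]
    | cons v G => simp [splitLR_cons, ih, hf]

theorem wordOf_cons (u : W) (F : List W) : wordOf (u :: F) = wordOf F ++ u := by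
  simp [wordOf]

theorem wordOf_filter (p : ℕ → Bool) (F : List W) :
    (wordOf F).filter p = wordOf (F.map (List.filter p)) := by
  induction F with
  | nil => simp [wordOf]
  | cons u F ih => simp [wordOf_cons, ih]

theorem wordOf_shiftF (m : ℕ) (F : List W) : wordOf (shiftF m F) = shiftW m (wordOf F) := by
  induction F with
  | nil => simp [wordOf, shiftF, shiftW]
  | cons u F ih =>
    have : shiftF m (u :: F) = shiftW m u :: shiftF m F := rfl
    rw [this, wordOf_cons, wordOf_cons, ih]
    simp [shiftW]

theorem wordOf_empties (F : List W) (h : ∀ w ∈ F, w = []) : wordOf F = [] := by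
  induction F with
  | nil => rfl
  | cons u F ih =>
    rw [wordOf_cons, ih (fun w hw => h w (by simp [hw])), h u (by simp)]
    rfl

theorem wordOf_splitLR_empties_right (F G : List W) (h : ∀ w ∈ G, w = []) :
    wordOf (splitLR F G) = wordOf F := by
  induction F generalizing G with
  | nil => rw [splitLR_nil_left, wordOf_empties G h]; rfl
  | cons u F ih =>
    cases G with
    | nil => rw [splitLR_nil_right]
    | cons v G =>
      rw [splitLR_cons, wordOf_cons, wordOf_cons, ih G (fun w hw => h w (by simp [hw])),
        h v (by simp), List.append_nil]

theorem wordOf_splitLR_empties_left (F G : List W) (h : ∀ w ∈ F, w = []) :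
    wordOf (splitLR F G) = wordOf G := by
  induction F generalizing G with
  | nil => rw [splitLR_nil_left]
  | cons u F ih =>
    cases G with
    | nil => rw [splitLR_nil_right, wordOf_empties _ h]; rfl
    | cons v G =>
      rw [splitLR_cons, wordOf_cons, wordOf_cons, ih G (fun w hw => h w (by simp [hw])),
        h u (by simp), List.nil_append]

theorem wordOf_splitLR_perm (F G : List W) :
    (wordOf (splitLR F G)).Perm (wordOf F ++ wordOf G) := by
  induction F generalizing G with
  | nil => simp [splitLR_nil_left, wordOf]
  | cons u F ih =>
    cases G with
    | nil => simp [splitLR_nil_right, wordOf]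
    | cons v G =>
      rw [splitLR_cons, wordOf_cons, wordOf_cons, wordOf_cons]
      refine ((ih G).append_right _).trans ?_
      rw [List.perm_iff_count]
      intro x
      simp only [List.count_append]
      omega

theorem splitProd_perm (a b : W) : (splitProd a b).Perm (a ++ shiftW a.length b) := by
  have := wordOf_splitLR_perm (LR a) (shiftF a.length (LR b))
  rwa [wordOf_LR, wordOf_shiftF, wordOf_LR] at this

theorem length_splitProd (a b : W) : (splitProd a b).length = a.length + b.length := by
  have := (splitProd_perm a b).length_eq
  simpa [shiftW] using this

/-- counting characterization -/
def CPF (a : W) : Prop :=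
  (∀ x ∈ a, 1 ≤ x) ∧ ∀ i ≤ a.length, i ≤ a.countP (fun x => decide (x ≤ i))

theorem sorted_count (s : W) (hs : s.Pairwise (· ≤ ·)) :
    (∀ i, i < s.length → s.getD i 0 ≤ i + 1) ↔
      ∀ i ≤ s.length, i ≤ s.countP (fun x => decide (x ≤ i)) := by
  constructor
  · intro h i hi
    have h1 : (s.take i).countP (fun x => decide (x ≤ i)) = (s.take i).length := by
      rw [List.countP_eq_length]
      intro x hx
      obtain ⟨j, hj, rfl⟩ := List.getElem_of_mem hx
      have hj' : j < i ∧ j < s.length := by simpa using hj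
      have := h j hj'.2
      rw [List.getD_eq_getElem _ _ hj'.2] at this
      simp only [List.getElem_take, decide_eq_true_eq]
      omega
    have h2 := (List.take_sublist i s).countP_le (p := fun x => decide (x ≤ i))
    rw [h1, List.length_take] at h2
    omega
  · intro h i hi
    by_contra hc
    have h1 := h (i + 1) hi
    have h2 : (s.drop i).countP (fun x => decide (x ≤ i + 1)) = 0 := by
      rw [List.countP_eq_zero]
      intro x hx
      obtain ⟨j, hj, rfl⟩ := List.getElem_of_mem hx
      have hj' : i + j < s.length := by simp at hj; omega
      rw [List.getD_eq_getElem _ _ hi] at hc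
      simp only [List.getElem_drop, decide_eq_true_eq]
      have : s[i] ≤ s[i + j] := by
        rcases Nat.eq_zero_or_pos j with rfl | hjp
        · simp
        · exact List.pairwise_iff_getElem.1 hs i (i + j) hi hj' (by omega)
      omega
    have h3 : (s.take i).countP (fun x => decide (x ≤ i + 1)) ≤ (s.take i).length :=
      List.countP_le_length
    have h4 : s.countP (fun x => decide (x ≤ i + 1)) =
        (s.take i).countP (fun x => decide (x ≤ i + 1)) +
        (s.drop i).countP (fun x => decide (x ≤ i + 1)) := by
      rw [← List.countP_append, List.take_append_drop]
    rw [List.length_take] at h3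
    omega

theorem isPF_iff (a : W) : IsPF a ↔ CPF a := by
  have hp := List.perm_insertionSort (· ≤ ·) a
  have := sorted_count (a.insertionSort (· ≤ ·)) (List.pairwise_insertionSort _ a)
  rw [hp.length_eq] at this
  simp only [hp.countP_eq] at this
  unfold IsPF CPF
  rw [this]

theorem IsPF.le_length {a : W} (h : IsPF a) : ∀ x ∈ a, x ≤ a.length := by
  have h1 := ((isPF_iff a).1 h).2 a.length le_rfl
  have h2 : a.countP (fun x => decide (x ≤ a.length)) = a.length :=
    le_antisymm List.countP_le_length h1
  rw [List.countP_eq_length] at h2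
  intro x hx
  simpa using h2 x hx

theorem IsPF_nil : IsPF [] := by simp [IsPF]

theorem IsPF.splitProd {a b : W} (ha : IsPF a) (hb : IsPF b) : IsPF (splitProd a b) := by
  have hal := ha.le_length
  rw [isPF_iff] at *
  have hp := splitProd_perm a b
  refine ⟨?_, ?_⟩
  · intro x hx
    rw [hp.mem_iff, List.mem_append] at hx
    rcases hx with hx | hx
    · exact ha.1 x hx
    · simp only [shiftW, List.mem_map] at hx
      obtain ⟨y, hy, rfl⟩ := hx
      have := hb.1 y hy
      omega
  · intro i hi
    rw [length_splitProd] at hi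
    rw [hp.countP_eq, List.countP_append]
    rcases le_total i a.length with h | h
    · have := ha.2 i h
      omega
    · have h1 : a.countP (fun x => decide (x ≤ i)) = a.length := by
        rw [List.countP_eq_length]
        intro x hx
        have := hal x hx
        simp; omega
      have h2 := hb.2 (i - a.length) (by omega)
      have h3 : (shiftW a.length b).countP (fun x => decide (x ≤ i)) =
          b.countP (fun x => decide (x ≤ i - a.length)) := by
        rw [shiftW, List.countP_map]
        apply List.countP_congr
        intro x _
        simp; omega
      omega

theorem headD_mem {w : W} (h : w ≠ []) : w.headD 0 ∈ w := by
  cases w with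
  | nil => exact absurd rfl h
  | cons x xs => simp

theorem splitLR_heads (F G : List W) (hF : ∀ w ∈ F, w ≠ []) :
    ∀ w ∈ splitLR F G, (∃ u ∈ F, w.headD 0 = u.headD 0) ∨ (∃ u ∈ G, w.headD 0 = u.headD 0) := by
  induction F generalizing G with
  | nil =>
    intro w hw
    rw [splitLR_nil_left] at hw
    exact Or.inr ⟨w, hw, rfl⟩
  | cons u F ih =>
    cases G with
    | nil =>
      intro w hw
      rw [splitLR_nil_right] at hw
      exact Or.inl ⟨w, hw, rfl⟩
    | cons v G =>
      intro w hw
      rw [splitLR_cons, List.mem_cons] at hw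
      rcases hw with rfl | hw
      · left
        refine ⟨u, by simp, ?_⟩
        have := hF u (by simp)
        cases u with
        | nil => exact absurd rfl this
        | cons x xs => simp
      · rcases ih G (fun w hw => hF w (by simp [hw])) w hw with ⟨t, ht, h⟩ | ⟨t, ht, h⟩
        · exact Or.inl ⟨t, by simp [ht], h⟩
        · exact Or.inr ⟨t, by simp [ht], h⟩

theorem vLR_splitLR (m : ℕ) (F G : List W) (hF : VLR F) (hG : VLR G)
    (hFm : ∀ w ∈ F, ∀ x ∈ w, x ≤ m) (hGm : ∀ w ∈ G, ∀ x ∈ w, m < x) :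
    VLR (splitLR F G) := by
  induction F generalizing G with
  | nil => rwa [splitLR_nil_left]
  | cons u F ih =>
    cases G with
    | nil => rwa [splitLR_nil_right]
    | cons v G =>
      obtain ⟨hF1, hF2⟩ := hF
      obtain ⟨hG1, hG2⟩ := hG
      rw [List.pairwise_cons] at hF2 hG2
      have h := ih G ⟨fun w hw => hF1 w (by simp [hw]), hF2.2⟩
        ⟨fun w hw => hG1 w (by simp [hw]), hG2.2⟩
        (fun w hw => hFm w (by simp [hw])) (fun w hw => hGm w (by simp [hw]))
      rw [splitLR_cons]
      have hu := hF1 u (by simp)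
      have hum := hFm u (by simp)
      have hvm := hGm v (by simp)
      have huh := hum _ (headD_mem hu.1)
      have hh : (u ++ v).headD 0 = u.headD 0 := by
        cases u with
        | nil => exact absurd rfl hu.1
        | cons x xs => simp
      refine ⟨?_, List.pairwise_cons.2 ⟨?_, h.2⟩⟩
      · intro w hw
        rcases List.mem_cons.1 hw with rfl | hw
        · refine ⟨by simp [hu.1], ?_⟩
          intro x hx
          rw [hh]
          rcases List.mem_append.1 hx with hx | hx
          · exact hu.2 x hx
          · have := hvm x hx
            omega
        · exact h.1 w hw
      · intro w hw
        rw [hh]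
        rcases splitLR_heads F G (fun w hw => (hF1 w (by simp [hw])).1) w hw with
          ⟨t, ht, h⟩ | ⟨t, ht, h⟩
        · rw [h]; exact hF2.1 t ht
        · rw [h]
          have := hGm t (by simp [ht]) _ (headD_mem (hG1 t (by simp [ht])).1)
          omega

theorem vLR_shiftF (m : ℕ) (F : List W) (h : VLR F) : VLR (shiftF m F) := by
  have hd : ∀ w : W, w ≠ [] → (shiftW m w).headD 0 = w.headD 0 + m := by
    intro w hw
    cases w with
    | nil => exact absurd rfl hw
    | cons x xs => simp [shiftW]
  refine ⟨?_, ?_⟩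
  · intro w hw
    obtain ⟨u, hu, rfl⟩ := List.mem_map.1 hw
    have h1 := h.1 u hu
    refine ⟨by simpa [shiftW] using h1.1, ?_⟩
    intro x hx
    rw [hd u h1.1]
    obtain ⟨y, hy, rfl⟩ := List.mem_map.1 hx
    have := h1.2 y hy
    simpa using this
  · rw [shiftF, List.pairwise_map]
    refine h.2.imp_of_mem ?_
    intro u v hu hv huv
    rw [hd u (h.1 u hu).1, hd v (h.1 v hv).1]
    omega

theorem LR_le {a : W} (ha : IsPF a) : ∀ w ∈ LR a, ∀ x ∈ w, x ≤ a.length := by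
  intro w hw x hx
  apply ha.le_length
  rw [← wordOf_LR a, mem_wordOf]
  exact ⟨w, hw, hx⟩

theorem shift_LR_gt {b : W} (hb : IsPF b) (m : ℕ) :
    ∀ w ∈ shiftF m (LR b), ∀ x ∈ w, m < x := by
  intro w hw x hx
  obtain ⟨u, hu, rfl⟩ := List.mem_map.1 hw
  obtain ⟨y, hy, rfl⟩ := List.mem_map.1 hx
  have := hb.1 y (by rw [← wordOf_LR b, mem_wordOf]; exact ⟨u, hu, hy⟩)
  show m < y + m
  omega

theorem LR_splitProd {a b : W} (ha : IsPF a) (hb : IsPF b) :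
    LR (splitProd a b) = splitLR (LR a) (shiftF a.length (LR b)) :=
  LR_wordOf _ (vLR_splitLR a.length _ _ (vLR_LR a) (vLR_shiftF _ _ (vLR_LR b))
    (LR_le ha) (shift_LR_gt hb _))

theorem shiftF_splitLR (m : ℕ) (F G : List W) :
    shiftF m (splitLR F G) = splitLR (shiftF m F) (shiftF m G) :=
  splitLR_map (shiftW m) (by simp [shiftW]) F G

theorem shiftF_shiftF (m n : ℕ) (F : List W) :
    shiftF m (shiftF n F) = shiftF (m + n) F := by
  simp only [shiftF, List.map_map]
  congr 1
  funext w
  simp only [shiftW, Function.comp, List.map_map]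
  congr 1
  funext x
  simp only [Function.comp]
  omega

theorem splitProd_assoc {a b c : W} (ha : IsPF a) (hb : IsPF b) (hc : IsPF c) :
    splitProd (splitProd a b) c = splitProd a (splitProd b c) := by
  rw [splitProd, LR_splitProd ha hb, splitProd.eq_1 a (splitProd b c), LR_splitProd hb hc,
    length_splitProd, shiftF_splitLR, shiftF_shiftF, splitLR_assoc]

theorem filter_le_splitProd {a b : W} (ha : IsPF a) (hb : IsPF b) :
    (splitProd a b).filter (fun x => decide (x ≤ a.length)) = a := by
  rw [splitProd, wordOf_filter, splitLR_map _ (by simp), wordOf_splitLR_empties_right,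
    ← wordOf_filter, wordOf_LR]
  · rw [List.filter_eq_self]
    intro x hx
    simpa using ha.le_length x hx
  · intro w hw
    obtain ⟨u, hu, rfl⟩ := List.mem_map.1 hw
    rw [List.filter_eq_nil_iff]
    intro x hx
    have := shift_LR_gt hb _ u hu x hx
    simpa using this

theorem filter_gt_splitProd {a b : W} (ha : IsPF a) (hb : IsPF b) :
    (splitProd a b).filter (fun x => decide (a.length < x)) = shiftW a.length b := by
  rw [splitProd, wordOf_filter, splitLR_map _ (by simp), wordOf_splitLR_empties_left,
    ← wordOf_filter, wordOf_shiftF, wordOf_LR]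
  · rw [List.filter_eq_self]
    intro x hx
    obtain ⟨y, hy, rfl⟩ := List.mem_map.1 hx
    have := hb.1 y hy
    simp; omega
  · intro w hw
    obtain ⟨u, hu, rfl⟩ := List.mem_map.1 hw
    rw [List.filter_eq_nil_iff]
    intro x hx
    have := LR_le ha u hu x hx
    simpa using this

theorem shiftW_inj (m : ℕ) {u v : W} (h : shiftW m u = shiftW m v) : u = v :=
  List.map_injective_iff.2 (add_left_injective m) h

/-- Words of `F` restricted to letters at most `k`, dropping empty ones. -/
def cut (k : ℕ) (F : List W) : List W :=
  (F.map (List.filter fun x => decide (x ≤ k))).filter (fun w => decide (w ≠ []))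

theorem filter_nil_of_head {w : W} (h : Dominated w) {k : ℕ} (hk : k < w.headD 0) :
    (w.filter fun x => decide (x ≤ k)) = [] := by
  rw [List.filter_eq_nil_iff]
  intro x hx
  have := h.2 x hx
  simp; omega

theorem filter_cons_of_head {w : W} (h : Dominated w) {k : ℕ} (hk : ¬ k < w.headD 0) :
    (w.filter fun x => decide (x ≤ k)) ≠ [] ∧
    (w.filter fun x => decide (x ≤ k)).headD 0 = w.headD 0 := by
  cases w with
  | nil => exact absurd rfl h.1
  | cons x xs =>
    have : x ≤ k := by simpa using hk
    simp [this]

theorem vLR_cut (k : ℕ) (F : List W) (h : VLR F) : VLR (cut k F) := by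
  refine ⟨?_, ?_⟩
  · intro w hw
    rw [cut, List.mem_filter] at hw
    obtain ⟨hw, hne⟩ := hw
    obtain ⟨u, hu, rfl⟩ := List.mem_map.1 hw
    have hd := h.1 u hu
    have hne' : (u.filter fun x => decide (x ≤ k)) ≠ [] := by simpa using hne
    have hk : ¬ k < u.headD 0 := fun hk => hne' (filter_nil_of_head hd hk)
    refine ⟨hne', ?_⟩
    intro x hx
    rw [(filter_cons_of_head hd hk).2]
    exact hd.2 x (List.mem_filter.1 hx).1
  · rw [cut, List.pairwise_filter, List.pairwise_map]
    refine h.2.imp_of_mem ?_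
    intro u v hu hv huv h1 h2
    have h1' : (u.filter fun x => decide (x ≤ k)) ≠ [] := by simpa using h1
    have h2' : (v.filter fun x => decide (x ≤ k)) ≠ [] := by simpa using h2
    have hk1 : ¬ k < u.headD 0 := fun hk => h1' (filter_nil_of_head (h.1 u hu) hk)
    have hk2 : ¬ k < v.headD 0 := fun hk => h2' (filter_nil_of_head (h.1 v hv) hk)
    rw [(filter_cons_of_head (h.1 u hu) hk1).2, (filter_cons_of_head (h.1 v hv) hk2).2]
    exact huv

theorem wordOf_nonempties (F : List W) :
    wordOf (F.filter (fun w => decide (w ≠ []))) = wordOf F := by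
  induction F with
  | nil => rfl
  | cons u F ih =>
    by_cases hu : u = []
    · rw [List.filter_cons_of_neg (by simp [hu]), ih, wordOf_cons, hu, List.append_nil]
    · rw [List.filter_cons_of_pos (by simp [hu]), wordOf_cons, wordOf_cons, ih]

theorem wordOf_cut (k : ℕ) (F : List W) :
    wordOf (cut k F) = (wordOf F).filter (fun x => decide (x ≤ k)) := by
  rw [cut, wordOf_nonempties, wordOf_filter]

theorem LR_filter (k : ℕ) (a : W) :
    LR (a.filter (fun x => decide (x ≤ k))) = cut k (LR a) := by
  rw [← LR_wordOf _ (vLR_cut k _ (vLR_LR a)), wordOf_cut, wordOf_LR]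

theorem splitLR_cut (k m : ℕ) (F G : List W) (h : VLR G) :
    wordOf (splitLR F (shiftF m (G.map (List.filter fun x => decide (x ≤ k))))) =
      wordOf (splitLR F (shiftF m (cut k G))) := by
  induction G generalizing F with
  | nil => rfl
  | cons v G ih =>
    obtain ⟨h1, h2⟩ := h
    rw [List.pairwise_cons] at h2
    by_cases hk : k < v.headD 0
    · have hall : ∀ w ∈ (v :: G), (w.filter fun x => decide (x ≤ k)) = [] := by
        intro w hw
        refine filter_nil_of_head (h1 w hw) ?_
        rcases List.mem_cons.1 hw with rfl | hw
        · exact hk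
        · exact hk.trans (h2.1 w hw)
      have hc : cut k (v :: G) = [] := by
        rw [cut, List.filter_eq_nil_iff]
        intro w hw
        obtain ⟨u, hu, rfl⟩ := List.mem_map.1 hw
        simp [hall u hu]
      rw [hc, wordOf_splitLR_empties_right, shiftF, List.map_nil, splitLR_nil_right]
      intro w hw
      obtain ⟨u, hu, rfl⟩ := List.mem_map.1 hw
      obtain ⟨t, ht, rfl⟩ := List.mem_map.1 hu
      rw [hall t ht]; rfl
    · have hne := (filter_cons_of_head (h1 v (by simp)) hk).1
      have hc : cut k (v :: G) = (v.filter fun x => decide (x ≤ k)) :: cut k G := by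
        rw [cut, List.map_cons, List.filter_cons_of_pos (by simpa using hne), cut]
      have ih' := fun F => ih F ⟨fun w hw => h1 w (by simp [hw]), h2.2⟩
      rw [hc, List.map_cons]
      simp only [shiftF, List.map_cons]
      cases F with
      | nil =>
        have := ih' []
        simp only [splitLR_nil_left, shiftF] at this
        rw [splitLR_nil_left, splitLR_nil_left, wordOf_cons, wordOf_cons, this]
      | cons u F =>
        have := ih' F
        simp only [shiftF] at this
        rw [splitLR_cons, splitLR_cons, wordOf_cons, wordOf_cons, this]

theorem levi {b c b' c' : W} (hb : IsPF b) (hc : IsPF c) (hb' : IsPF b') (hc' : IsPF c')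
    (h : splitProd b c = splitProd b' c') (hl : b.length < b'.length) :
    ∃ d, IsPF d ∧ d ≠ [] ∧ b' = splitProd b d := by
  obtain ⟨k, hk⟩ : ∃ k, b'.length = b.length + k := ⟨b'.length - b.length, by omega⟩
  have key : b' = splitProd b (c.filter (fun x => decide (x ≤ k))) := by
    conv_lhs => rw [← filter_le_splitProd hb' hc', ← h]
    rw [splitProd, wordOf_filter, splitLR_map _ (by simp), splitProd, LR_filter,
      ← splitLR_cut _ _ _ _ (vLR_LR c)]
    congr 2
    · conv_rhs => rw [← List.map_id (LR b)]
      apply List.map_congr_left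
      intro w hw
      rw [id, List.filter_eq_self]
      intro x hx
      have := LR_le hb w hw x hx
      simp; omega
    · simp only [shiftF, List.map_map]
      apply List.map_congr_left
      intro w hw
      simp only [Function.comp, shiftW, List.filter_map]
      congr 1
      apply List.filter_congr
      intro x hx
      simp only [Function.comp, hk]
      apply decide_eq_decide.2
      omega
  have hlen : (c.filter (fun x => decide (x ≤ k))).length = k := by
    have := congrArg List.length key
    rw [length_splitProd] at this
    omega
  have hlc : k ≤ c.length := by
    have := congrArg List.length h
    rw [length_splitProd, length_splitProd] at this
    omega
  refine ⟨_, ?_, ?_, key⟩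
  · rw [isPF_iff] at hc ⊢
    refine ⟨fun x hx => hc.1 x (List.mem_filter.1 hx).1, ?_⟩
    intro i hi
    rw [hlen] at hi
    have := hc.2 i (hi.trans hlc)
    rw [List.countP_filter]
    refine this.trans (le_of_eq (List.countP_congr ?_))
    intro x _
    simp; omega
  · intro h0
    rw [h0] at hlen
    simp at hlen
    omega

theorem splitProd_nil (a : W) : splitProd a [] = a := by
  have : LR [] = [] := by simp [LR, segs]
  rw [splitProd, this, shiftF, List.map_nil, splitLR_nil_right, wordOf_LR]

theorem nil_splitProd (a : W) : splitProd [] a = a := by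
  have h := wordOf_shiftF 0 (LR a)
  have : LR [] = [] := by simp [LR, segs]
  rw [splitProd, this, splitLR_nil_left, List.length_nil, h, wordOf_LR]
  simp [shiftW]

theorem fold_PF (L : List W) (h : ∀ x ∈ L, UnsplitablePF x) : IsPF (L.foldr splitProd []) := by
  induction L with
  | nil => exact IsPF_nil
  | cons x L ih =>
    exact (h x (by simp)).1.splitProd (ih fun y hy => h y (by simp [hy]))

theorem fold_append (L M : List W) (hL : ∀ x ∈ L, UnsplitablePF x)
    (hM : ∀ x ∈ M, UnsplitablePF x) :
    (L ++ M).foldr splitProd [] = splitProd (L.foldr splitProd []) (M.foldr splitProd []) := by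
  induction L with
  | nil => simp [nil_splitProd]
  | cons x L ih =>
    have hL' : ∀ y ∈ L, UnsplitablePF y := fun y hy => hL y (by simp [hy])
    rw [List.cons_append, List.foldr_cons, List.foldr_cons, ih hL',
      splitProd_assoc (hL x (by simp)).1 (fold_PF L hL') (fold_PF M hM)]

theorem exists_fact (n : ℕ) (a : W) (hn : a.length ≤ n) (ha : IsPF a) :
    ∃ L : List W, (∀ x ∈ L, UnsplitablePF x) ∧ L.foldr splitProd [] = a := by
  induction n generalizing a with
  | zero =>
    exact ⟨[], by simp, (List.eq_nil_of_length_eq_zero (by omega)).symm⟩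
  | succ n ih =>
    by_cases h0 : a = []
    · exact ⟨[], by simp, h0.symm⟩
    by_cases hu : UnsplitablePF a
    · exact ⟨[a], by simpa using hu, by simp [splitProd_nil]⟩
    · have : ∃ b c : W, IsPF b ∧ IsPF c ∧ b ≠ [] ∧ c ≠ [] ∧ a = splitProd b c := by
        by_contra hc
        exact hu ⟨ha, h0, hc⟩
      obtain ⟨b, c, hb, hc, hb0, hc0, rfl⟩ := this
      rw [length_splitProd] at hn
      have h1 := List.length_pos_iff.2 hb0
      have h2 := List.length_pos_iff.2 hc0
      obtain ⟨L, hL, hL'⟩ := ih b (by omega) hb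
      obtain ⟨M, hM, hM'⟩ := ih c (by omega) hc
      refine ⟨L ++ M, ?_, by rw [fold_append L M hL hM, hL', hM']⟩
      intro x hx
      rcases List.mem_append.1 hx with hx | hx
      · exact hL x hx
      · exact hM x hx

theorem fold_cons_ne (x : W) (L : List W) (h : UnsplitablePF x) :
    (x :: L).foldr splitProd [] ≠ [] := by
  intro h0
  have h1 := congrArg List.length h0
  rw [List.foldr_cons, length_splitProd] at h1
  have h2 := List.length_pos_iff.2 h.2.1
  rw [List.length_nil] at h1
  omega

theorem unique_fact (L M : List W) (hL : ∀ x ∈ L, UnsplitablePF x)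
    (hM : ∀ x ∈ M, UnsplitablePF x) (h : L.foldr splitProd [] = M.foldr splitProd []) :
    L = M := by
  induction L generalizing M with
  | nil =>
    cases M with
    | nil => rfl
    | cons y M => exact absurd h.symm (fold_cons_ne y M (hM y (by simp)))
  | cons x L ih =>
    cases M with
    | nil => exact absurd h (fold_cons_ne x L (hL x (by simp)))
    | cons y M =>
      have hx := hL x (by simp)
      have hy := hM y (by simp)
      have hL' : ∀ y ∈ L, UnsplitablePF y := fun y hy => hL y (by simp [hy])
      have hM' : ∀ y ∈ M, UnsplitablePF y := fun y hy => hM y (by simp [hy])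
      have hfL := fold_PF L hL'
      have hfM := fold_PF M hM'
      rw [List.foldr_cons, List.foldr_cons] at h
      rcases lt_trichotomy x.length y.length with hlt | heq | hlt
      · obtain ⟨d, hd, hd0, hyd⟩ := levi hx.1 hfL hy.1 hfM h hlt
        exact absurd ⟨x, d, hx.1, hd, hx.2.1, hd0, hyd⟩ hy.2.2
      · have e1 := filter_le_splitProd hx.1 hfL
        have e2 := filter_gt_splitProd hx.1 hfL
        rw [h, heq, filter_le_splitProd hy.1 hfM] at e1
        rw [h, heq, filter_gt_splitProd hy.1 hfM] at e2
        rw [e1, ih M hL' hM' (shiftW_inj _ e2).symm]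
      · obtain ⟨d, hd, hd0, hyd⟩ := levi hy.1 hfM hx.1 hfL h.symm hlt
        exact absurd ⟨y, d, hy.1, hd, hy.2.1, hd0, hyd⟩ hx.2.2

/-- The split product `∘` is associative on nonempty parking
functions, and every nonempty parking function factors uniquely as a split
product of unsplitable parking functions. -/
theorem stmt8 :
    (∀ a b c : W, IsPF a → IsPF b → IsPF c → a ≠ [] → b ≠ [] → c ≠ [] →
      splitProd (splitProd a b) c = splitProd a (splitProd b c)) ∧
    (∀ a : W, IsPF a → a ≠ [] →
      ∃! L : List W, (∀ x ∈ L, UnsplitablePF x) ∧ L.foldr splitProd [] = a) := by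
  refine ⟨fun a b c ha hb hc _ _ _ => splitProd_assoc ha hb hc, ?_⟩
  intro a ha _
  obtain ⟨L, hL, hLa⟩ := exists_fact a.length a le_rfl ha
  refine ⟨L, ⟨hL, hLa⟩, ?_⟩
  rintro M ⟨hM, hMa⟩
  exact unique_fact M L hM hL (hMa.trans hLa.symm)
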